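/- Under the stepsize condition α ≤ (1 + λ_n(W))/L_h and β < 1, the sum of the local objective values along the decentralized gradient descent iterates never exceeds its initial value: Σ_{i=1}^n f_i(x_{(i)}(k)) ≤ Σ_{i=1}^n f_i(0) for all k ≥ 0. -/

import Mathlib

open scoped RealInnerProductSpace

lemma aux_descent {E : Type*} [NormedAddCommGroup E] [InnerProductSpace ℝ E] [CompleteSpace E]
    (f : E → ℝ) (g : E → E) (L : ℝ) (hL : 0 < L)
    (hg : ∀ z, HasGradientAt f (g z) z) (hl : LipschitzWith L.toNNReal g) (x d : E) :
    f (x + d) ≤ f x + ⟪g x, d⟫ + L / 2 * ‖d‖ ^ 2 := by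
  let φ : ℝ → ℝ := fun t => f (x + t • d) - t * ⟪g x, d⟫ - t ^ 2 * (L / 2 * ‖d‖ ^ 2)
  have hder : ∀ t : ℝ, HasDerivAt φ
      (⟪g (x + t • d), d⟫ - ⟪g x, d⟫ - 2 * t * (L / 2 * ‖d‖ ^ 2)) t := by
    intro t
    have h1 : HasDerivAt (fun t : ℝ => x + t • d) d t := by
      simpa using ((hasDerivAt_id t).smul_const d).const_add x
    have h2 := (hg (x + t • d)).hasFDerivAt.comp_hasDerivAt t h1
    have h3 : HasDerivAt (fun t : ℝ => t * ⟪g x, d⟫) ⟪g x, d⟫ t := by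
      simpa using (hasDerivAt_id t).mul_const ⟪g x, d⟫
    have h4 : HasDerivAt (fun t : ℝ => t ^ 2 * (L / 2 * ‖d‖ ^ 2)) (2 * t * (L / 2 * ‖d‖ ^ 2)) t := by
      simpa using (hasDerivAt_pow 2 t).mul_const (L / 2 * ‖d‖ ^ 2)
    have h5 := (h2.sub h3).sub h4
    simp only [InnerProductSpace.toDual_apply_apply] at h5
    exact h5
  have hanti : AntitoneOn φ (Set.Icc 0 1) := by
    refine antitoneOn_of_hasDerivWithinAt_nonpos (convex_Icc 0 1)
      (fun t _ => (hder t).continuousAt.continuousWithinAt)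
      (fun t _ => (hder t).hasDerivWithinAt) ?_
    intro t ht
    rw [interior_Icc] at ht
    have h1 : ⟪g (x + t • d) - g x, d⟫ ≤ ‖g (x + t • d) - g x‖ * ‖d‖ := real_inner_le_norm _ _
    have h2 : ‖g (x + t • d) - g x‖ ≤ L * (t * ‖d‖) := by
      have := hl.dist_le_mul (x + t • d) x
      rw [dist_eq_norm, dist_eq_norm, Real.coe_toNNReal _ hL.le] at this
      simpa [norm_smul, abs_of_pos ht.1] using this
    rw [inner_sub_left] at h1
    have h3 := mul_le_mul_of_nonneg_right h2 (norm_nonneg d)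
    nlinarith
  have := hanti (Set.left_mem_Icc.2 zero_le_one) (Set.right_mem_Icc.2 zero_le_one) zero_le_one
  simp only [φ, one_smul, zero_smul, add_zero] at this
  linarith

lemma aux_psd {n : ℕ} (W : Matrix (Fin n) (Fin n) ℝ) (hW : W.IsHermitian) (c : ℝ)
    (hc : ∀ i, c ≤ hW.eigenvalues i) (v : Fin n → ℝ) :
    c * ∑ i, v i ^ 2 ≤ ∑ i, ∑ j, W i j * (v i * v j) := by
  have hH : (W - algebraMap ℝ _ c).IsHermitian := by
    refine hW.sub ?_
    rw [Matrix.algebraMap_eq_diagonal]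
    exact Matrix.isHermitian_diagonal _
  have hP : (W - algebraMap ℝ _ c).PosSemidef := by
    rw [hH.posSemidef_iff_eigenvalues_nonneg]
    intro i
    have h1 : hH.eigenvalues i ∈ spectrum ℝ (W - algebraMap ℝ _ c) := by
      rw [hH.spectrum_real_eq_range_eigenvalues]; exact ⟨i, rfl⟩
    rw [← spectrum.sub_singleton_eq, hW.spectrum_real_eq_range_eigenvalues] at h1
    obtain ⟨a, ⟨j, rfl⟩, b, hb, h⟩ := h1
    rw [Set.mem_singleton_iff] at hb
    subst hb
    have := hc j
    simp only at h
    simp only [Pi.zero_apply]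
    linarith
  have h := hP.dotProduct_mulVec_nonneg v
  rw [Matrix.sub_mulVec, dotProduct_sub, Matrix.algebraMap_eq_diagonal] at h
  have e1 : star v ⬝ᵥ W.mulVec v = ∑ i, ∑ j, W i j * (v i * v j) := by
    simp only [dotProduct, Matrix.mulVec, Finset.mul_sum, star_trivial]
    refine Finset.sum_congr rfl fun i _ => Finset.sum_congr rfl fun j _ => by ring
  have e2 : star v ⬝ᵥ (Matrix.diagonal (algebraMap ℝ (Fin n → ℝ) c)).mulVec v
      = c * ∑ i, v i ^ 2 := by
    simp only [dotProduct, Matrix.mulVec_diagonal, Finset.mul_sum, star_trivial]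
    refine Finset.sum_congr rfl fun i _ => by simp; ring
  rw [e1, e2] at h
  linarith

lemma aux_psd_vec {n p : ℕ} (W : Matrix (Fin n) (Fin n) ℝ) (hW : W.IsHermitian) (c : ℝ)
    (hc : ∀ i, c ≤ hW.eigenvalues i) (d : Fin n → EuclideanSpace ℝ (Fin p)) :
    c * ∑ i, ‖d i‖ ^ 2 ≤ ∑ i, ∑ j, W i j * ⟪d i, d j⟫ := by
  have h := Finset.sum_le_sum fun (q : Fin p) (_ : q ∈ Finset.univ) =>
    aux_psd W hW c hc (fun i => d i q)
  have e1 : ∑ q, c * ∑ i, d i q ^ 2 = c * ∑ i, ‖d i‖ ^ 2 := by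
    rw [← Finset.mul_sum, Finset.sum_comm]
    simp [EuclideanSpace.norm_sq_eq]
  have e2 : ∑ q, ∑ i, ∑ j, W i j * (d i q * d j q) = ∑ i, ∑ j, W i j * ⟪d i, d j⟫ := by
    rw [Finset.sum_comm]
    refine Finset.sum_congr rfl fun i _ => ?_
    rw [Finset.sum_comm]
    refine Finset.sum_congr rfl fun j _ => ?_
    rw [← Finset.mul_sum]
    congr 1
    simp [PiLp.inner_apply, mul_comm]
  rw [e1, e2] at h
  exact h

lemma aux_le {n p : ℕ} (W : Matrix (Fin n) (Fin n) ℝ) 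
    (h0 : ∀ i j, 0 ≤ W i j) (hr : ∀ i, ∑ j, W i j = 1) (hcl : ∀ j, ∑ i, W i j = 1)
    (d : Fin n → EuclideanSpace ℝ (Fin p)) :
    ∑ i, ∑ j, W i j * ⟪d i, d j⟫ ≤ ∑ i, ‖d i‖ ^ 2 := by
  have h : ∑ i, ∑ j, W i j * ⟪d i, d j⟫ ≤
      ∑ i, ∑ j, (W i j * (‖d i‖ ^ 2 / 2) + W i j * (‖d j‖ ^ 2 / 2)) := by
    refine Finset.sum_le_sum fun i _ => Finset.sum_le_sum fun j _ => ?_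
    rw [← mul_add]
    refine mul_le_mul_of_nonneg_left ?_ (h0 i j)
    have := real_inner_le_norm (d i) (d j)
    nlinarith [sq_nonneg (‖d i‖ - ‖d j‖)]
  refine h.trans (le_of_eq ?_)
  simp only [Finset.sum_add_distrib]
  rw [Finset.sum_comm (f := fun i j => W i j * (‖d j‖ ^ 2 / 2))]
  simp only [← Finset.sum_mul, hr, hcl, ← Finset.sum_add_distrib]
  refine Finset.sum_congr rfl fun i _ => by ring

theorem sum_objective_bounded_by_initial
    {n p : ℕ} (hn : 0 < n)
    (f : Fin n → EuclideanSpace ℝ (Fin p) → ℝ)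
    (gf : Fin n → EuclideanSpace ℝ (Fin p) → EuclideanSpace ℝ (Fin p))
    (Lf : Fin n → ℝ) (hLfpos : ∀ i, 0 < Lf i)
    (hconv : ∀ i, ConvexOn ℝ Set.univ (f i))
    (hbdd : ∀ i, BddBelow (Set.range (f i)))
    (hgrad : ∀ i z, HasGradientAt (f i) (gf i z) z)
    (hlip : ∀ i, LipschitzWith (Lf i).toNNReal (gf i))
    (Lh : ℝ) (hLh : Lh = ⨆ i, Lf i)
    (W : Matrix (Fin n) (Fin n) ℝ)
    (hWsymm : W.IsHermitian)
    (hWnonneg : ∀ i j, 0 ≤ W i j)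
    (hWrow : ∀ i, ∑ j, W i j = 1)
    (hWcol : ∀ j, ∑ i, W i j = 1)
    (lam : Fin n → ℝ) (hlamAnti : Antitone lam)
    (hlamEig : ∃ σ : Equiv.Perm (Fin n), lam = hWsymm.eigenvalues ∘ σ)
    (hlam1 : lam ⟨0, hn⟩ = 1)
    (lamN : ℝ) (hlamN : lamN = lam ⟨n - 1, Nat.sub_lt hn Nat.one_pos⟩)
    (hlamNlb : -1 ≤ lamN)
    (β : ℝ) (hβdef : β = ⨆ j : {j : Fin n // j ≠ (⟨0, hn⟩ : Fin n)}, |lam j.1|)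
    (α : ℝ) (hα : 0 < α)
    (x : ℕ → Fin n → EuclideanSpace ℝ (Fin p))
    (hiter : ∀ k i, x (k + 1) i = (∑ j, W i j • x k j) - α • gf i (x k i))
    (hx0 : ∀ i, x 0 i = 0)
    (hstep : α ≤ (1 + lamN) / Lh)
    (hβlt : β < 1)
 :
    ∀ k, ∑ i, f i (x k i) ≤ ∑ i, f i 0 := by
  have hLle : ∀ i, Lf i ≤ Lh := fun i => hLh ▸ le_ciSup (Set.finite_range Lf).bddAbove i
  have hLpos : 0 < Lh := (hLfpos ⟨0, hn⟩).trans_le (hLle _)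
  rw [le_div_iff₀ hLpos] at hstep
  have hc : ∀ i, lamN ≤ hWsymm.eigenvalues i := by
    obtain ⟨σ, hσ⟩ := hlamEig
    intro i
    have : hWsymm.eigenvalues i = lam (σ.symm i) := by simp [hσ]
    rw [this, hlamN]
    apply hlamAnti
    rw [Fin.le_def]
    have := (σ.symm i).2
    simp only
    omega
  let B : (Fin n → EuclideanSpace ℝ (Fin p)) → (Fin n → EuclideanSpace ℝ (Fin p)) → ℝ :=
    fun u v => ∑ i, ∑ j, W i j * ⟪u i, v j⟫
  let N : (Fin n → EuclideanSpace ℝ (Fin p)) → ℝ := fun u => ∑ i, ‖u i‖ ^ 2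
  let F : (Fin n → EuclideanSpace ℝ (Fin p)) → ℝ := fun u => ∑ i, f i (u i)
  have hstepk : ∀ k, 2 * α * F (x (k + 1)) + (N (x (k + 1)) - B (x (k + 1)) (x (k + 1)))
      ≤ 2 * α * F (x k) + (N (x k) - B (x k) (x k)) := by
    intro k
    obtain ⟨d, hd⟩ : ∃ d : Fin n → EuclideanSpace ℝ (Fin p), ∀ i, x (k + 1) i = x k i + d i :=
      ⟨fun i => x (k + 1) i - x k i, fun i => (add_sub_cancel (x k i) (x (k + 1) i)).symm⟩
    have hx' : x (k + 1) = x k + d := funext hd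
    have hg : ∀ i, α • gf i (x k i) = (∑ j, W i j • x k j) - x k i - d i := by
      intro i
      have h1 := hiter k i
      rw [hd] at h1
      rw [sub_sub, h1]; abel
    have hF : 2 * α * F (x (k + 1)) ≤ 2 * α * F (x k)
        + 2 * (B d (x k) - ∑ i, ⟪d i, x k i⟫ - N d) + α * Lh * N d := by
      simp only [F, B, N, Finset.mul_sum, ← Finset.sum_sub_distrib, ← Finset.sum_add_distrib]
      refine Finset.sum_le_sum fun i _ => ?_
      have h1 := aux_descent (f i) (gf i) (Lf i) (hLfpos i) (hgrad i) (hlip i) (x k i) (d i)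
      have h2 : α * ⟪gf i (x k i), d i⟫ = ∑ j, W i j * ⟪d i, x k j⟫ - ⟪d i, x k i⟫ - ‖d i‖ ^ 2 := by
        rw [← real_inner_smul_left, hg, real_inner_comm, inner_sub_right, inner_sub_right, inner_sum,
          real_inner_self_eq_norm_sq]
        simp only [real_inner_smul_right]
      rw [hd]
      have h3 := mul_le_mul_of_nonneg_left h1 (by positivity : 0 ≤ 2 * α)
      have h4 : α * Lf i * ‖d i‖ ^ 2 ≤ α * Lh * ‖d i‖ ^ 2 := by
        have := hLle i
        gcongr
      have h5 : ∑ j, 2 * (W i j * ⟪d i, x k j⟫) = 2 * ∑ j, W i j * ⟪d i, x k j⟫ := by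
        rw [Finset.mul_sum]
      nlinarith
    have hN : N (x (k + 1)) = N (x k) + 2 * ∑ i, ⟪d i, x k i⟫ + N d := by
      simp only [N, Finset.mul_sum, ← Finset.sum_add_distrib]
      refine Finset.sum_congr rfl fun i _ => ?_
      rw [hd, norm_add_sq_real, real_inner_comm]
    have hsym : B (x k) d = B d (x k) := by
      simp only [B]
      rw [Finset.sum_comm]
      refine Finset.sum_congr rfl fun i _ => Finset.sum_congr rfl fun j _ => ?_
      rw [real_inner_comm]
      congr 1
      simpa using hWsymm.apply i j
    have hB : B (x (k + 1)) (x (k + 1)) = B (x k) (x k) + B (x k) d + B d (x k) + B d d := by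
      simp only [B, ← Finset.sum_add_distrib]
      refine Finset.sum_congr rfl fun i _ => Finset.sum_congr rfl fun j _ => ?_
      rw [hd, hd, inner_add_left, inner_add_right, inner_add_right]; ring
    have hBd : lamN * N d ≤ B d d := aux_psd_vec W hWsymm lamN hc d
    have hNd : 0 ≤ N d := Finset.sum_nonneg fun i _ => by positivity
    have := mul_le_mul_of_nonneg_right hstep hNd
    rw [hN, hB, hsym]
    nlinarith
  have hall : ∀ k, 2 * α * F (x k) + (N (x k) - B (x k) (x k)) ≤ 2 * α * ∑ i, f i 0 := by
    intro k
    induction k with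
    | zero => simp [F, N, B, hx0]
    | succ k ih => exact (hstepk k).trans ih
  intro k
  have h1 : B (x k) (x k) ≤ N (x k) := aux_le W hWnonneg hWrow hWcol (x k)
  have h2 := hall k
  have h3 : 2 * α * F (x k) ≤ 2 * α * ∑ i, f i 0 := by linarith
  exact le_of_mul_le_mul_left h3 (by positivity)
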